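/- Let k ≥ 2 be an integer and let x ∈ A_k^ℕ satisfy δ_{s_k}(x) = p for some finite p ∈ ℕ. Then for every integer n ≥ 1, the word w_n = s_k^n(x_{[0…p−1]}) · s_k^{n−1}(0) · s_k^{n−2}(0) · … · s_k(0) · 0 is a prefix of the sequence s_k^n(x), the word w_n belongs to L_{s_k}, and the prefix of s_k^n(x) of length |w_n| + 1 does not belong to L_{s_k}; i.e., w_n is the maximal prefix of s_k^n(x) lying in L_{s_k}. -/

import Mathlib

/-- The `k`-bonacci substitution on letters: `a ↦ 0(a+1)` if `a ≠ k-1`, and `k-1 ↦ 0`. -/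
def sLetter {k : ℕ} (a : Fin k) : List (Fin k) :=
  if h : (a : ℕ) + 1 < k then
    [⟨0, Nat.lt_of_le_of_lt (Nat.zero_le _) a.isLt⟩, ⟨(a : ℕ) + 1, h⟩]
  else
    [⟨0, Nat.lt_of_le_of_lt (Nat.zero_le _) a.isLt⟩]

/-- Extension of the substitution to finite words by concatenation. -/
def sWord {k : ℕ} (w : List (Fin k)) : List (Fin k) := w.flatMap sLetter

/-- The prefix of length `n` of a right-infinite sequence. -/
def pref {k : ℕ} (x : ℕ → Fin k) (n : ℕ) : List (Fin k) :=
  (List.range n).map x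

/-- Extension of the substitution to right-infinite sequences, by concatenating the
images of the letters: since each letter has a nonempty image, the `m`-th letter of the
image is the `m`-th letter of the image of the prefix of length `m+1`. -/
def sSeq {k : ℕ} (x : ℕ → Fin k) : ℕ → Fin k :=
  fun m => (sWord (pref x (m + 1))).getD m (x 0)

/-- The left shift on sequences. -/
def shift {k : ℕ} (x : ℕ → Fin k) : ℕ → Fin k := fun n => x (n + 1)

/-- The language of the substitution: finite words occurring as a subword of some `s^m(a)`. -/
def Lang {k : ℕ} (w : List (Fin k)) : Prop :=
  ∃ (a : Fin k) (m : ℕ), w <:+: sWord^[m] [a]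

/-- `delta x = sup {n : prefix of x of length n is in the language}`, valued in `ℕ∞`. -/
noncomputable def delta {k : ℕ} (x : ℕ → Fin k) : ℕ∞ :=
  sSup {N : ℕ∞ | ∃ n : ℕ, N = (n : ℕ∞) ∧ Lang (pref x n)}

/-- The subshift associated to the substitution: sequences all of whose subwords
lie in the language. -/
def Attr (k : ℕ) : Set (ℕ → Fin k) :=
  {x | ∀ i n, Lang ((List.range n).map (fun j => x (i + j)))}

/-- The renormalization operator. -/
noncomputable def Renorm {k : ℕ} (V : (ℕ → Fin k) → ℝ) : (ℕ → Fin k) → ℝ :=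
  fun x => ∑ j ∈ Finset.range (sLetter (x 0)).length, V (shift^[j] (sSeq x))

/-- `vcoef k lam l = lam^{-(k-1-l)} * ∑_{j=0}^{k-1-l} lam^j`. -/
noncomputable def vcoef (k : ℕ) (lam : ℝ) (l : ℕ) : ℝ :=
  (∑ j ∈ Finset.range (k - l), lam ^ j) / lam ^ (k - 1 - l)

/-- The fixed point of the renormalization operator. -/
noncomputable def Ufix (k : ℕ) (lam : ℝ) (x : ℕ → Fin k) : ℝ :=
  if delta x = ⊤ then 0
  else Real.log (1 + vcoef k lam (x 0) /
    (lam / (lam - 1)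
      + (∑ l : Fin k, vcoef k lam (l : ℕ) * ((pref x (delta x).toNat).count l : ℝ))
      - vcoef k lam (x 0)))

/-- The word `s^n(0) · s^{n-1}(0) ⋯ s(0) · 0`. -/
def bword {k : ℕ} (z : Fin k) (n : ℕ) : List (Fin k) :=
  ((List.range (n + 1)).map (fun i => sWord^[n - i] [z])).flatten

/-- The word `s^{n-1}(0) · s^{n-2}(0) ⋯ s(0) · 0`. -/
def bsuffix {k : ℕ} (z : Fin k) (n : ℕ) : List (Fin k) :=
  ((List.range n).map (fun i => sWord^[n - 1 - i] [z])).flatten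

/-- The cyclic successor `a ↦ a + 1 mod k`, where `z` is the letter `0`. -/
def cyclicSucc {k : ℕ} (z a : Fin k) : Fin k :=
  if h : (a : ℕ) + 1 < k then ⟨(a : ℕ) + 1, h⟩ else z

theorem cyclicSucc_injective {k : ℕ} {z : Fin k} (hz : (z : ℕ) = 0) :
    Function.Injective (cyclicSucc z) := by
  intro a b h
  have ha := a.isLt
  have hb := b.isLt
  unfold cyclicSucc at h
  apply Fin.ext
  split_ifs at h <;> simp only [Fin.ext_iff] at h <;> omega

theorem sLetter_cases {k : ℕ} {z : Fin k} (hz : (z : ℕ) = 0) (a : Fin k) :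
    (sLetter a = [z, cyclicSucc z a] ∧ cyclicSucc z a ≠ z) ∨
      (sLetter a = [z] ∧ cyclicSucc z a = z) := by
  have hz' : (⟨0, Nat.lt_of_le_of_lt (Nat.zero_le _) a.isLt⟩ : Fin k) = z := Fin.ext hz.symm
  unfold sLetter cyclicSucc
  split_ifs with h
  · left
    refine ⟨by rw [hz'], fun e => ?_⟩
    have := congrArg Fin.val e
    simp only at this
    omega
  · right
    exact ⟨by rw [hz'], rfl⟩

theorem sWord_nil {k : ℕ} : sWord ([] : List (Fin k)) = [] := rfl

theorem sWord_cons {k : ℕ} (a : Fin k) (w : List (Fin k)) :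
    sWord (a :: w) = sLetter a ++ sWord w := by
  simp [sWord]

theorem sWord_append {k : ℕ} (v w : List (Fin k)) : sWord (v ++ w) = sWord v ++ sWord w := by
  simp [sWord]

theorem sWord_iterate_append {k : ℕ} (m : ℕ) (v w : List (Fin k)) :
    sWord^[m] (v ++ w) = sWord^[m] v ++ sWord^[m] w := by
  induction m generalizing v w with
  | zero => rfl
  | succ m ih => simp only [Function.iterate_succ_apply, sWord_append, ih]

theorem sWord_cons_eq_cons {k : ℕ} {z : Fin k} (hz : (z : ℕ) = 0) (a : Fin k)
    (w : List (Fin k)) : ∃ r, sWord (a :: w) = z :: r := by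
  rw [sWord_cons]
  rcases sLetter_cases hz a with ⟨h, -⟩ | ⟨h, -⟩ <;> simp [h]

theorem length_le_length_sWord {k : ℕ} (w : List (Fin k)) : w.length ≤ (sWord w).length := by
  induction w with
  | nil => simp
  | cons a w ih =>
    have : 1 ≤ (sLetter a).length := by unfold sLetter; split_ifs <;> simp
    rw [sWord_cons, List.length_append, List.length_cons]
    omega

theorem length_le_length_sWord_iterate {k : ℕ} (m : ℕ) (w : List (Fin k)) :
    w.length ≤ (sWord^[m] w).length := by
  induction m with
  | zero => rfl
  | succ m ih =>
    rw [Function.iterate_succ_apply']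
    exact ih.trans (length_le_length_sWord _)

theorem List.IsPrefix.map_sWord {k : ℕ} {v w : List (Fin k)} (h : v <+: w) :
    sWord v <+: sWord w := by
  obtain ⟨t, rfl⟩ := h
  rw [sWord_append]
  exact List.prefix_append _ _

theorem List.IsInfix.map_sWord_iterate {k : ℕ} {v w : List (Fin k)} (h : v <:+: w) (m : ℕ) :
    sWord^[m] v <:+: sWord^[m] w := by
  obtain ⟨s, t, rfl⟩ := h
  simp only [sWord_iterate_append]
  exact ⟨_, _, rfl⟩

/-- Every letter occurs in an iterated image of `0`. -/
theorem exists_singleton_infix_sWord_iterate {k : ℕ} {z : Fin k} (hz : (z : ℕ) = 0)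
    (a : Fin k) : ∃ m, [a] <:+: sWord^[m] [z] := by
  obtain ⟨a, ha⟩ := a
  induction a with
  | zero => exact ⟨0, by simp [Fin.ext_iff, hz]⟩
  | succ a ih =>
    obtain ⟨m, hm⟩ := ih (by omega)
    refine ⟨m + 1, ?_⟩
    rw [Function.iterate_succ_apply']
    refine List.IsInfix.trans ?_ (hm.map_sWord_iterate 1)
    simp only [Function.iterate_one, sWord, sLetter, ha, List.flatMap_cons, List.flatMap_nil]
    exact ⟨[⟨0, by omega⟩], [], by simp⟩

/-- Images of words of the language can be extended to the right by the letter `0`. -/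
theorem Lang.sWord_append_zero {k : ℕ} (hk : 2 ≤ k) {z : Fin k} (hz : (z : ℕ) = 0)
    {w : List (Fin k)} (hw : Lang w) : Lang (sWord w ++ [z]) := by
  obtain ⟨a, m, hm⟩ := hw
  obtain ⟨j, hj⟩ := exists_singleton_infix_sWord_iterate hz a
  have h := hm.trans (hj.map_sWord_iterate m)
  rw [← Function.iterate_add_apply] at h
  refine ⟨z, m + j + 2, ?_⟩
  have hs : sWord [z] = [z, ⟨1, hk⟩] := by
    have h1 : 1 < k := hk
    simp [sWord, sLetter, hz, h1, Fin.ext_iff]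
  have hlen := length_le_length_sWord_iterate (m + j) [(⟨1, hk⟩ : Fin k)]
  rw [Function.iterate_succ_apply', Function.iterate_succ_apply, hs,
    show [z, (⟨1, hk⟩ : Fin k)] = [z] ++ [⟨1, hk⟩] from rfl, sWord_iterate_append]
  obtain ⟨s, t, hst⟩ := h
  rw [← hst]
  obtain ⟨b, r, hb⟩ : ∃ b r, t ++ sWord^[m + j] [(⟨1, hk⟩ : Fin k)] = b :: r := by
    apply List.exists_cons_of_ne_nil
    intro h0
    simp only [List.append_eq_nil_iff] at h0
    simp [h0.2] at hlen
  rw [List.append_assoc, hb, sWord_append, sWord_append]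
  obtain ⟨r', hr'⟩ := sWord_cons_eq_cons hz b r
  rw [hr']
  exact ⟨sWord s, r', by simp⟩

/-- Occurrences in `sWord W` of words starting with `0` begin at block boundaries. -/
theorem exists_suffix_of_cons_infix_sWord {k : ℕ} {z : Fin k} (hz : (z : ℕ) = 0)
    {r W : List (Fin k)} (h : z :: r <:+: sWord W) :
    ∃ V, V <:+ W ∧ z :: r <+: sWord V := by
  induction W with
  | nil => simp [sWord_nil] at h
  | cons b W ih =>
    have lift : z :: r <:+: sWord W → ∃ V, V <:+ b :: W ∧ z :: r <+: sWord V := fun h' => by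
      obtain ⟨V, hV, hp⟩ := ih h'
      exact ⟨V, hV.trans (List.suffix_cons _ _), hp⟩
    have h0 := h
    rw [sWord_cons] at h0
    rcases sLetter_cases hz b with ⟨hb, hc⟩ | ⟨hb, -⟩
    · rw [hb, List.cons_append, List.infix_cons_iff] at h0
      rcases h0 with h0 | h0
      · exact ⟨b :: W, List.suffix_rfl, by rw [sWord_cons, hb]; exact h0⟩
      · rw [List.cons_append, List.infix_cons_iff, List.cons_prefix_cons] at h0
        rcases h0 with h0 | h0
        · exact absurd h0.1.symm hc
        · exact lift h0
    · rw [hb, List.cons_append, List.infix_cons_iff] at h0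
      rcases h0 with h0 | h0
      · exact ⟨b :: W, List.suffix_rfl, by rw [sWord_cons, hb]; exact h0⟩
      · exact lift h0

/-- Unique decoding of prefixes of `sWord W`. -/
theorem append_singleton_prefix_of_sWord_prefix {k : ℕ} {z : Fin k} (hz : (z : ℕ) = 0)
    {a : Fin k} {u W : List (Fin k)} (h : sWord u ++ [z, cyclicSucc z a] <+: sWord W) :
    u ++ [a] <+: W := by
  induction u generalizing W with
  | nil =>
    cases W with
    | nil => simp [sWord_nil] at h
    | cons b W =>
      suffices a = b by simp [this]
      apply cyclicSucc_injective hz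
      rw [sWord_cons] at h
      rcases sLetter_cases hz b with ⟨hb, -⟩ | ⟨hb, hc⟩
      · simp only [hb, sWord_nil, List.nil_append, List.cons_append,
          List.cons_prefix_cons] at h
        exact h.2.1
      · cases W with
        | nil => simp [hb, sWord_nil] at h
        | cons d W =>
          obtain ⟨r, hr⟩ := sWord_cons_eq_cons hz d W
          simp only [hb, hr, sWord_nil, List.nil_append, List.cons_append,
            List.cons_prefix_cons] at h
          rw [h.2.1, hc]
  | cons d u ih =>
    cases W with
    | nil => simp [sWord_nil] at h
    | cons b W =>
      obtain ⟨t, ht⟩ : ∃ t, sWord u ++ [z, cyclicSucc z a] = z :: t := by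
        cases u with
        | nil => exact ⟨_, rfl⟩
        | cons e u =>
          obtain ⟨r, hr⟩ := sWord_cons_eq_cons hz e u
          exact ⟨_, by rw [hr, List.cons_append]⟩
      suffices d = b by
        subst this
        rw [sWord_cons, sWord_cons, List.append_assoc, List.prefix_append_right_inj] at h
        simpa using ih h
      apply cyclicSucc_injective hz
      rw [sWord_cons, sWord_cons, List.append_assoc, ht] at h
      rcases sLetter_cases hz d with ⟨hd, hd'⟩ | ⟨hd, hd'⟩ <;>
      rcases sLetter_cases hz b with ⟨hb, hb'⟩ | ⟨hb, hb'⟩ <;>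
      simp only [hd, hb, List.nil_append, List.cons_append, List.cons_prefix_cons] at h
      · exact h.2.1
      · cases W with
        | nil => simp [sWord_nil] at h
        | cons e W =>
          obtain ⟨r, hr⟩ := sWord_cons_eq_cons hz e W
          rw [hr, List.cons_prefix_cons] at h
          exact absurd h.2.1 hd'
      · exact absurd h.2.1.symm hb'
      · rw [hd', hb']

theorem Lang.of_sWord_append {k : ℕ} {z : Fin k} (hz : (z : ℕ) = 0) {a : Fin k}
    {u : List (Fin k)} (h : Lang (sWord u ++ [z, cyclicSucc z a])) : Lang (u ++ [a]) := by
  obtain ⟨c, m, hm⟩ := h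
  cases m with
  | zero =>
    have := hm.length_le
    simp at this
  | succ m =>
    rw [Function.iterate_succ_apply'] at hm
    obtain ⟨t, ht⟩ : ∃ t, sWord u ++ [z, cyclicSucc z a] = z :: t := by
      cases u with
      | nil => exact ⟨_, rfl⟩
      | cons e u =>
        obtain ⟨r, hr⟩ := sWord_cons_eq_cons hz e u
        exact ⟨_, by rw [hr, List.cons_append]⟩
    rw [ht] at hm
    obtain ⟨V, hV, hp⟩ := exists_suffix_of_cons_infix_sWord hz hm
    rw [← ht] at hp
    exact ⟨c, m, (append_singleton_prefix_of_sWord_prefix hz hp).isInfix.trans hV.isInfix⟩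

theorem length_pref {k : ℕ} (x : ℕ → Fin k) (n : ℕ) : (pref x n).length = n := by
  simp [pref]

theorem pref_succ {k : ℕ} (x : ℕ → Fin k) (n : ℕ) : pref x (n + 1) = pref x n ++ [x n] := by
  simp [pref, List.range_succ]

theorem pref_prefix_pref {k : ℕ} (x : ℕ → Fin k) {m n : ℕ} (h : m ≤ n) :
    pref x m <+: pref x n := by
  induction n, h using Nat.le_induction with
  | base => exact List.prefix_rfl
  | succ n _ ih => exact ih.trans (pref_succ x n ▸ List.prefix_append _ _)

theorem pref_sSeq_of_prefix {k : ℕ} (x : ℕ → Fin k) {w : List (Fin k)} {n : ℕ}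
    (h : w <+: sWord (pref x n)) : pref (sSeq x) w.length = w := by
  apply List.ext_getElem (length_pref _ _)
  intro i h1 h2
  have hi : i < (sWord (pref x (i + 1))).length := by
    have := length_le_length_sWord (pref x (i + 1))
    rw [length_pref] at this
    omega
  simp only [pref, List.getElem_map, List.getElem_range, sSeq]
  rw [← pref, List.getD_eq_getElem _ _ hi]
  have hm := (pref_prefix_pref x (le_max_left (i + 1) n)).map_sWord
  have hn := h.trans (pref_prefix_pref x (le_max_right (i + 1) n)).map_sWord
  rw [hm.getElem hi, hn.getElem h2]

/-- `u` is the longest prefix of `x` lying in the language. -/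
def IsMaximalPrefix {k : ℕ} (x : ℕ → Fin k) (u : List (Fin k)) : Prop :=
  pref x u.length = u ∧ Lang u ∧ ¬ Lang (pref x (u.length + 1))

theorem IsMaximalPrefix.map_sSeq {k : ℕ} (hk : 2 ≤ k) {z : Fin k} (hz : (z : ℕ) = 0)
    {x : ℕ → Fin k} {u : List (Fin k)} (h : IsMaximalPrefix x u) :
    IsMaximalPrefix (sSeq x) (sWord u ++ [z]) := by
  obtain ⟨hu, hL, hN⟩ := h
  rw [pref_succ, hu] at hN
  have key : sWord u ++ [z, cyclicSucc z (x u.length)] <+: sWord (pref x (u.length + 2)) := by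
    rw [pref_succ, pref_succ, hu, List.append_assoc, sWord_append, List.prefix_append_right_inj,
      List.singleton_append, sWord_cons]
    rcases sLetter_cases hz (x u.length) with ⟨h, -⟩ | ⟨h, hc⟩
    · simp [h]
    · obtain ⟨r, hr⟩ := sWord_cons_eq_cons hz (x (u.length + 1)) []
      simp [h, hr, hc]
  refine ⟨pref_sSeq_of_prefix x (List.IsPrefix.trans ⟨[cyclicSucc z (x u.length)], by simp⟩ key),
    hL.sWord_append_zero hk hz, fun h => hN (Lang.of_sWord_append hz ?_)⟩
  rw [← pref_sSeq_of_prefix x key]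
  simpa using h

theorem isMaximalPrefix_of_delta_eq {k : ℕ} (z : Fin k) {x : ℕ → Fin k} {p : ℕ}
    (hp : delta x = (p : ℕ∞)) : IsMaximalPrefix x (pref x p) := by
  have hmax : ∀ n : ℕ, Lang (pref x n) → n ≤ p := fun n hn => by
    have : (n : ℕ∞) ≤ delta x := le_sSup ⟨n, rfl, hn⟩
    rw [hp] at this
    exact_mod_cast this
  refine ⟨by rw [length_pref], ?_, fun h => ?_⟩
  · obtain ⟨n, hn, hL⟩ : delta x ∈ {N : ℕ∞ | ∃ n : ℕ, N = (n : ℕ∞) ∧ Lang (pref x n)} := by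
      have : Nonempty {N : ℕ∞ | ∃ n : ℕ, N = (n : ℕ∞) ∧ Lang (pref x n)} :=
        ⟨0, 0, rfl, z, 0, List.nil_infix⟩
      apply ENat.sSup_mem_of_nonempty_of_lt_top
      exact lt_of_eq_of_lt hp (ENat.natCast_lt_top p)
    rw [hp] at hn
    rwa [Nat.cast_inj.mp hn]
  · rw [length_pref] at h
    have := hmax _ h
    omega

theorem bsuffix_succ {k : ℕ} (z : Fin k) (n : ℕ) :
    bsuffix z (n + 1) = sWord (bsuffix z n) ++ [z] := by
  have hflat : ∀ l : List (List (Fin k)), sWord l.flatten = (l.map sWord).flatten := fun l => by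
    induction l with
    | nil => rfl
    | cons a l ih => simp [sWord_append, ih]
  simp only [bsuffix, hflat, List.range_succ, List.map_append, List.flatten_append, List.map_map]
  congr 2
  · apply List.map_congr_left
    intro i hi
    rw [List.mem_range] at hi
    rw [Function.comp_apply, ← Function.iterate_succ_apply' sWord]
    congr 2
    omega
  · simp

theorem stmt2 (k : ℕ) (hk : 2 ≤ k) (z0 : Fin k) (hz : (z0 : ℕ) = 0)
    (x : ℕ → Fin k) (p : ℕ) (hp : delta x = (p : ℕ∞)) (n : ℕ) (hn : 1 ≤ n) :
    pref (sSeq^[n] x) (sWord^[n] (pref x p) ++ bsuffix z0 n).length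
        = sWord^[n] (pref x p) ++ bsuffix z0 n
    ∧ Lang (sWord^[n] (pref x p) ++ bsuffix z0 n)
    ∧ ¬ Lang (pref (sSeq^[n] x) ((sWord^[n] (pref x p) ++ bsuffix z0 n).length + 1)) := by
  change IsMaximalPrefix _ _
  clear hn
  induction n with
  | zero => simpa [bsuffix] using isMaximalPrefix_of_delta_eq z0 hp
  | succ n ih =>
    simpa only [Function.iterate_succ_apply', bsuffix_succ, sWord_append, List.append_assoc]
      using ih.map_sSeq hk hz
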